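/- arXiv:1812.01517 — 7 statements merged into one kernel-verified Lean document; each statement's English description precedes it below -/
import Mathlib

section
/- Let a, b, c, d, e, f, g > 0 and set σ = a + b + c + g. Consider the network N with boundary vertices v1, v2, v3, w and one internal vertex u, with edges and conductances: (v1,u): b, (v2,u): c, (v3,u): a, (u,w): g, (v1,v2): e, (v2,v3): f, (v1,v3): d. Then the 4×4 response matrix of N (the Schur complement of its Kirchhoff matrix eliminating u), with boundary order (v1, v2, v3, w), equals the Kirchhoff matrix, in vertex order (v1, v2, v3, w'), of the network N' in which all four vertices v1, v2, v3, w' are boundary vertices and whose edges have conductances: (v1,w'): bg/σ, (v2,w'): cg/σ, (v3,w'): ag/σ, (v1,v2): e + bc/σ, (v2,v3): f + ac/σ, (v1,v3): d + ab/σ. (This is the antenna absorption move: the degree-one interior boundary vertex w is absorbed into the internal vertex u, which becomes the boundary vertex w'.) -/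
open Matrix

/-- Kirchhoff matrix of a resistor network with symmetric edge-weight function `w`
(with `w v v = 0`, i.e. no self-loops): off-diagonal entries are the total
conductance between the two vertices, diagonal entries are minus the total
conductance of all incident edges. -/
def kirchhoff {V : Type*} [Fintype V] [DecidableEq V] (w : V → V → ℝ) :
    Matrix V V ℝ :=
  Matrix.of fun u v => if u = v then -∑ x, w u x else w u v

/-- Response matrix of a network whose vertices are `Fin nb ⊕ Fin ni`
(boundary vertices `Sum.inl`, internal vertices `Sum.inr`): the Schur
complement of the Kirchhoff matrix eliminating the internal vertices. -/
noncomputable def response {nb ni : ℕ} (w : (Fin nb ⊕ Fin ni) → (Fin nb ⊕ Fin ni) → ℝ) :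
    Matrix (Fin nb) (Fin nb) ℝ :=
  (Matrix.of fun i j => kirchhoff w (Sum.inl i) (Sum.inl j)) -
    (Matrix.of fun i j => kirchhoff w (Sum.inl i) (Sum.inr j)) *
      (Matrix.of fun i j => kirchhoff w (Sum.inr i) (Sum.inr j))⁻¹ *
      (Matrix.of fun i j => kirchhoff w (Sum.inr i) (Sum.inl j))

/-- Symmetric edge-weight function determined by a list of edges with
conductances. -/
def wOf {V : Type*} [DecidableEq V] (es : List (V × V × ℝ)) : V → V → ℝ :=
  fun u v =>
    (es.map fun e =>
      if (e.1 = u ∧ e.2.1 = v) ∨ (e.1 = v ∧ e.2.1 = u) then e.2.2 else 0).sum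

/-- With a single internal vertex `u`, the response matrix is obtained from the Kirchhoff matrix
by one step of Gaussian elimination with pivot `u`. -/
theorem response_apply_of_one_internal {nb : ℕ} (w : (Fin nb ⊕ Fin 1) → (Fin nb ⊕ Fin 1) → ℝ)
    (i j : Fin nb) :
    response w i j = kirchhoff w (Sum.inl i) (Sum.inl j) -
      kirchhoff w (Sum.inl i) (Sum.inr 0) * (kirchhoff w (Sum.inr 0) (Sum.inr 0))⁻¹ *
        kirchhoff w (Sum.inr 0) (Sum.inl j) := by
  simp [response, Matrix.mul_apply]

/-- **The antenna absorption move preserves the response matrix.**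
Boundary order `(v1, v2, v3, w)`; the network `N` has one internal vertex `u`.
`N` has edges `(v1,u) : b`, `(v2,u) : c`, `(v3,u) : a`, `(u,w) : g`,
`(v1,v2) : e`, `(v2,v3) : f`, `(v1,v3) : d`, and its response matrix equals
the Kirchhoff matrix of the network `N'` on four boundary vertices
`(v1, v2, v3, w')` with edges `(v1,w') : bg/σ`, `(v2,w') : cg/σ`,
`(v3,w') : ag/σ`, `(v1,v2) : e + bc/σ`, `(v2,v3) : f + ac/σ`,
`(v1,v3) : d + ab/σ`, where `σ = a + b + c + g`. -/
theorem antenna_absorption (a b c d e f g σ : ℝ)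
    (ha : 0 < a) (hb : 0 < b) (hc : 0 < c) (hd : 0 < d)
    (he : 0 < e) (hf : 0 < f) (hg : 0 < g)
    (hσ : σ = a + b + c + g) :
    response
        (wOf ([(Sum.inl 0, Sum.inr 0, b), (Sum.inl 1, Sum.inr 0, c),
               (Sum.inl 2, Sum.inr 0, a), (Sum.inr 0, Sum.inl 3, g),
               (Sum.inl 0, Sum.inl 1, e), (Sum.inl 1, Sum.inl 2, f),
               (Sum.inl 0, Sum.inl 2, d)] :
          List ((Fin 4 ⊕ Fin 1) × (Fin 4 ⊕ Fin 1) × ℝ)))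
      = kirchhoff
          (wOf ([(0, 3, b * g / σ), (1, 3, c * g / σ), (2, 3, a * g / σ),
                 (0, 1, e + b * c / σ), (1, 2, f + a * c / σ),
                 (0, 2, d + a * b / σ)] :
            List (Fin 4 × Fin 4 × ℝ))) := by
  have hσ0 : σ ≠ 0 := by rw [hσ]; positivity
  set w : Fin 4 ⊕ Fin 1 → Fin 4 ⊕ Fin 1 → ℝ := wOf _ with hw
  have hpivot : kirchhoff w (Sum.inr 0) (Sum.inr 0) = -σ := by
    simp [hw, kirchhoff, wOf, Fin.sum_univ_four, hσ]
    ring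
  ext i j
  rw [response_apply_of_one_internal, hpivot]
  fin_cases i <;> fin_cases j <;>
    simp [hw, kirchhoff, wOf, Fin.sum_univ_four] <;> field_simp <;> subst hσ <;> ring
end

section
/- Let A, B, C, D, E, F > 0 and set Σ = B + D + E + F. Define a = (AB + AD + AE + AF + BD)/Σ, b = BF/Σ, c = (BC + BE + CD + CE + CF)/Σ, d = DF/Σ, e = EF/Σ, f = DE/Σ. Consider the network N2 with boundary vertices v0, v2, v3, w and one internal vertex x, with edges and conductances: (x,w): B, (v2,w): C, (v3,w): A, (x,v2): E, (x,v3): D, (v0,x): F. Then the 4×4 response matrix of N2 (the Schur complement of its Kirchhoff matrix eliminating x), with boundary order (v0, v2, v3, w), equals the Kirchhoff matrix, in vertex order (v1, v2, v3, w), of the network N1 in which all four vertices v1, v2, v3, w are boundary vertices and whose edges have conductances: (v1,w): b, (v2,w): c, (v3,w): a, (v1,v2): e, (v2,v3): f, (v1,v3): d. (This is one direction of the triangle conditional local move for networks in a punctured disk, with w the interior boundary vertex.) -/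
open Matrix

/-- **Triangle conditional local move (one direction).**
With `S = B + D + E + F` and
`a = (AB+AD+AE+AF+BD)/S`, `b = BF/S`, `c = (BC+BE+CD+CE+CF)/S`,
`d = DF/S`, `e = EF/S`, `f = DE/S`:
the response matrix (boundary order `(v0, v2, v3, w)`) of the network `N2`
with internal vertex `x` and edges `(x,w) : B`, `(v2,w) : C`, `(v3,w) : A`,
`(x,v2) : E`, `(x,v3) : D`, `(v0,x) : F` equals the Kirchhoff matrix (vertex
order `(v1, v2, v3, w)`) of the all-boundary network `N1` with edges
`(v1,w) : b`, `(v2,w) : c`, `(v3,w) : a`, `(v1,v2) : e`, `(v2,v3) : f`,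
`(v1,v3) : d`. -/
theorem triangle_move_forward (A B C D E F S a b c d e f : ℝ)
    (hA : 0 < A) (hB : 0 < B) (hC : 0 < C) (hD : 0 < D)
    (hE : 0 < E) (hF : 0 < F)
    (hS : S = B + D + E + F)
    (ha : a = (A * B + A * D + A * E + A * F + B * D) / S)
    (hb : b = B * F / S)
    (hc : c = (B * C + B * E + C * D + C * E + C * F) / S)
    (hd : d = D * F / S)
    (he : e = E * F / S)
    (hf : f = D * E / S) :
    response
        (wOf ([(Sum.inr 0, Sum.inl 3, B), (Sum.inl 1, Sum.inl 3, C),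
               (Sum.inl 2, Sum.inl 3, A), (Sum.inr 0, Sum.inl 1, E),
               (Sum.inr 0, Sum.inl 2, D), (Sum.inl 0, Sum.inr 0, F)] :
          List ((Fin 4 ⊕ Fin 1) × (Fin 4 ⊕ Fin 1) × ℝ)))
      = kirchhoff
          (wOf ([(0, 3, b), (1, 3, c), (2, 3, a),
                 (0, 1, e), (1, 2, f), (0, 2, d)] :
            List (Fin 4 × Fin 4 × ℝ))) := by
  have hS0 : B + D + E + F ≠ 0 := by positivity
  have hx : kirchhoff
      (wOf ([(Sum.inr 0, Sum.inl 3, B), (Sum.inl 1, Sum.inl 3, C),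
             (Sum.inl 2, Sum.inl 3, A), (Sum.inr 0, Sum.inl 1, E),
             (Sum.inr 0, Sum.inl 2, D), (Sum.inl 0, Sum.inr 0, F)] :
        List ((Fin 4 ⊕ Fin 1) × (Fin 4 ⊕ Fin 1) × ℝ))) (Sum.inr 0) (Sum.inr 0)
      = -(B + D + E + F) := by
    simp [kirchhoff, wOf, Fin.sum_univ_four]
    ring
  subst hS ha hb hc hd he hf
  ext i j
  rw [response_apply_of_one_internal, hx, inv_neg]
  fin_cases i <;> fin_cases j <;>
    simp [kirchhoff, wOf, Fin.sum_univ_four] <;>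
    field_simp <;> ring
end

section
/- Let a, b, c, d, e, f > 0 and set s = bf + de + df + ef. Define A = (ea − bf)/e, B = b·s/(de), C = (cd − bf)/d, D = s/e, E = s/d, F = s/f. Consider the network N1 in which all four vertices v1, v2, v3, w are boundary vertices, with edges and conductances: (v1,w): b, (v2,w): c, (v3,w): a, (v1,v2): e, (v2,v3): f, (v1,v3): d; its response matrix is its Kirchhoff matrix. Then this Kirchhoff matrix, in vertex order (v1, v2, v3, w), equals the 4×4 response matrix (the Schur complement of the Kirchhoff matrix eliminating the internal vertex x), with boundary order (v0, v2, v3, w), of the network N2 with boundary vertices v0, v2, v3, w, internal vertex x, and edges with conductances: (x,w): B, (v2,w): C, (v3,w): A, (x,v2): E, (x,v3): D, (v0,x): F. (This is the other direction of the triangle conditional local move; no sign conditions on A and C are needed for the matrix identity.) -/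
open Matrix

/-- **Triangle conditional local move (other direction).**
With `s = bf + de + df + ef` and `A = (ea - bf)/e`, `B = b·s/(de)`,
`C = (cd - bf)/d`, `D = s/e`, `E = s/d`, `F = s/f`:
the Kirchhoff matrix (vertex order `(v1, v2, v3, w)`) of the all-boundary
network `N1` with edges `(v1,w) : b`, `(v2,w) : c`, `(v3,w) : a`,
`(v1,v2) : e`, `(v2,v3) : f`, `(v1,v3) : d` equals the response matrix
(boundary order `(v0, v2, v3, w)`) of the network `N2` with internal vertex
`x` and edges `(x,w) : B`, `(v2,w) : C`, `(v3,w) : A`, `(x,v2) : E`,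
`(x,v3) : D`, `(v0,x) : F`.  No sign conditions on `A` and `C` are needed. -/
theorem triangle_move_backward (a b c d e f s A B C D E F : ℝ)
    (ha : 0 < a) (hb : 0 < b) (hc : 0 < c) (hd : 0 < d)
    (he : 0 < e) (hf : 0 < f)
    (hs : s = b * f + d * e + d * f + e * f)
    (hA : A = (e * a - b * f) / e)
    (hB : B = b * s / (d * e))
    (hC : C = (c * d - b * f) / d)
    (hD : D = s / e)
    (hE : E = s / d)
    (hF : F = s / f) :
    kirchhoff
        (wOf ([(0, 3, b), (1, 3, c), (2, 3, a),
               (0, 1, e), (1, 2, f), (0, 2, d)] :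
          List (Fin 4 × Fin 4 × ℝ)))
      = response
          (wOf ([(Sum.inr 0, Sum.inl 3, B), (Sum.inl 1, Sum.inl 3, C),
                 (Sum.inl 2, Sum.inl 3, A), (Sum.inr 0, Sum.inl 1, E),
                 (Sum.inr 0, Sum.inl 2, D), (Sum.inl 0, Sum.inr 0, F)] :
            List ((Fin 4 ⊕ Fin 1) × (Fin 4 ⊕ Fin 1) × ℝ))) := by
  have hs_pos : 0 < s := by rw [hs]; positivity
  have hsum : B + E + D + F = s ^ 2 / (d * e * f) := by
    rw [hB, hE, hD, hF]
    field_simp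
    rw [hs]
    ring
  have hx : kirchhoff
      (wOf ([(Sum.inr 0, Sum.inl 3, B), (Sum.inl 1, Sum.inl 3, C),
             (Sum.inl 2, Sum.inl 3, A), (Sum.inr 0, Sum.inl 1, E),
             (Sum.inr 0, Sum.inl 2, D), (Sum.inl 0, Sum.inr 0, F)] :
        List ((Fin 4 ⊕ Fin 1) × (Fin 4 ⊕ Fin 1) × ℝ))) (Sum.inr 0) (Sum.inr 0)
      = -(s ^ 2 / (d * e * f)) := by
    rw [← hsum]
    simp [kirchhoff, wOf, Fin.sum_univ_four]
    ring
  ext i j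
  simp only [response, Matrix.sub_apply, Matrix.mul_apply, Fin.sum_univ_one,
    Matrix.inv_subsingleton, Matrix.of_apply, Matrix.diagonal_apply_eq, Ring.inverse_eq_inv', hx]
  fin_cases i <;> fin_cases j <;>
    simp [kirchhoff, wOf, Fin.sum_univ_four, hA, hB, hC, hD, hE, hF] <;>
    field_simp <;> (try rw [hs]) <;> ring
end

section
/- Let A, B, C, D, E, F, G, H, I, J, K, L, M > 0. Set α = ABM + AFM + AGM + ALM + BFM + BJM + BKM + FGM + FJM + FKL + FKM + FLM + GJM + GKM + JLM + KLM and β = FKL + FKM + FLM + KLM. Define a = A(β + BKM + GKM)/α, b = B(β + ALM + JLM)/α, c = C + (ABGIM + AFGIM + BFGIM + BGIJM + BGIKM − DFGJM)/(Iα), d = D + D(DFGJM + HFGJM + IFGJM)/(IHα), e = E + (ABHJM + AFHJM + AGHJM + AHJLM + BFHJM − DFGJM)/(Hα), f = (β + BKM + GKM)(β + ALM + JLM)/(KLα), g = G(β + ALM + JLM)/α, h = H + (DFGJM + HFGJM + IFGJM)/(Iα), i = I + (DFGJM + HFGJM + IFGJM)/(Hα), j = J(β + BKM + GKM)/α, k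 = (β + BKM + GKM)/(FL), ℓ = (β + ALM + JLM)/(KF), m = (HIα + DFGJM + HFGJM + IFGJM)/(FGJM). Consider the network P2 with boundary vertices z, pl, pr, pt, t_k, t_ℓ and internal vertices pbl, pbr, with edges and conductances: (z,pbr): A, (z,pbl): B, (z,pl): C, (z,pt): D, (z,pr): E, (pbr,pbl): F, (pbl,pl): G, (pl,pt): H, (pt,pr): I, (pr,pbr): J, (t_k,pbr): K, (t_ℓ,pbl): L, (t_k,t_ℓ): M. Consider the network P1 with boundary vertices z, pl, pr, t_m, t_k, t_ℓ and internal vertices pt, pbl, pbr, with edges and conductances: (z,pbr): a, (z,pbl): b, (z,pl): c, (z,pt): d, (z,pr): e, (pbr,pbl): f, (pbl,pl): g, (pl,pt): h, (pt,pr): i, (pr,pbr): j, (t_k,pbr): k, (t_ℓ,pbl): ℓ, (t_m,pt): m. Then the 6×6 response matrix of P2 (Schur complement eliminating pbl, pbr) with boundary order (z, pl, pr, pt, t_k, t_ℓ) equals the 6×6 response matrix of P1 (Schur complement eliminating pt, pbl, pbr) with boundary order (z, pl, pr, t_m, t_k, t_ℓ). (This is the reverse direction of the pentagon conditional local move; the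 correspondence sends pt to t_m.) -/
open Matrix

theorem kirchhoff_mulVec_eq_sum {V : Type*} [Fintype V] [DecidableEq V] (w : V → V → ℝ)
    (u : V → ℝ) (x : V) (hw : w x x = 0) :
    (kirchhoff w *ᵥ u) x = ∑ y, w x y * (u y - u x) := by
  have key : ∀ y, kirchhoff w x y * u y
      = w x y * u y + if x = y then (-∑ z, w x z) * u x else 0 := by
    intro y
    by_cases hxy : x = y
    · subst hxy
      simp [kirchhoff, hw]
    · simp [kirchhoff, hxy]
  simp only [Matrix.mulVec, dotProduct, key, Finset.sum_add_distrib, Finset.sum_ite_eq,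
    Finset.mem_univ, if_true, mul_sub, Finset.sum_sub_distrib, ← Finset.sum_mul]
  ring

/-- The current at a vertex is the sum of the currents along its incident edges. -/
theorem kirchhoff_wOf_mulVec {V : Type*} [Fintype V] [DecidableEq V] (es : List (V × V × ℝ))
    (u : V → ℝ) (x : V) (hes : ∀ e ∈ es, e.1 ≠ e.2.1) :
    (kirchhoff (wOf es) *ᵥ u) x = (es.map fun e =>
      if e.1 = x then e.2.2 * (u e.2.1 - u x)
      else if e.2.1 = x then e.2.2 * (u e.1 - u x) else 0).sum := by
  have hloop : wOf es x x = 0 := by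
    refine List.sum_eq_zero fun r hr => ?_
    obtain ⟨e, he, rfl⟩ := List.mem_map.mp hr
    exact if_neg fun h => hes e he (by grind)
  rw [kirchhoff_mulVec_eq_sum _ _ _ hloop]
  clear hloop
  induction es with
  | nil => simp [wOf]
  | cons e es ih =>
    have hne := hes e List.mem_cons_self
    rw [List.map_cons, List.sum_cons, ← ih fun e' he' => hes e' (List.mem_cons_of_mem _ he')]
    simp only [wOf, List.map_cons, List.sum_cons, add_mul, Finset.sum_add_distrib]
    congr 1
    by_cases h₁ : e.1 = x
    · have h₂ : e.2.1 ≠ x := fun h => hne (h₁.trans h.symm)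
      simp [h₁, h₂]
    · by_cases h₂ : e.2.1 = x <;> simp [h₁, h₂]

theorem kirchhoff_mulVec_eq_add {nb ni : ℕ} (w : (Fin nb ⊕ Fin ni) → (Fin nb ⊕ Fin ni) → ℝ)
    (u : Fin nb ⊕ Fin ni → ℝ) (v : Fin nb ⊕ Fin ni) :
    (kirchhoff w *ᵥ u) v =
      ((Matrix.of fun (_ : Unit) j => kirchhoff w v (Sum.inl j)) *ᵥ (u ∘ Sum.inl)) ()
      + ((Matrix.of fun (_ : Unit) j => kirchhoff w v (Sum.inr j)) *ᵥ (u ∘ Sum.inr)) () := by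
  simp [Matrix.mulVec, dotProduct, Fintype.sum_sum_type]

/-- The response matrix sends boundary potentials to the boundary currents of any
harmonic extension. -/
theorem response_mulVec_of_harmonic {nb ni : ℕ}
    (w : (Fin nb ⊕ Fin ni) → (Fin nb ⊕ Fin ni) → ℝ) (u : Fin nb ⊕ Fin ni → ℝ)
    (hdet : (Matrix.of fun i j => kirchhoff w (Sum.inr i) (Sum.inr j)).det ≠ 0)
    (hu : ∀ i, (kirchhoff w *ᵥ u) (Sum.inr i) = 0) :
    response w *ᵥ (u ∘ Sum.inl) = fun i => (kirchhoff w *ᵥ u) (Sum.inl i) := by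
  have hint : (Matrix.of fun i j => kirchhoff w (Sum.inr i) (Sum.inl j)) *ᵥ (u ∘ Sum.inl)
      = -((Matrix.of fun i j => kirchhoff w (Sum.inr i) (Sum.inr j)) *ᵥ (u ∘ Sum.inr)) := by
    ext i
    have := hu i
    rw [kirchhoff_mulVec_eq_add] at this
    exact eq_neg_of_add_eq_zero_left this
  have hdet' := isUnit_iff_ne_zero.mpr hdet
  ext i
  rw [kirchhoff_mulVec_eq_add, response, Matrix.sub_mulVec, ← Matrix.mulVec_mulVec, hint,
    Matrix.mulVec_neg, Matrix.mulVec_mulVec, Matrix.mul_assoc, Matrix.nonsing_inv_mul _ hdet',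
    Matrix.mul_one, sub_neg_eq_add]
  rfl

theorem exists_harmonic_extension {nb ni : ℕ}
    (w : (Fin nb ⊕ Fin ni) → (Fin nb ⊕ Fin ni) → ℝ) (v : Fin nb → ℝ)
    (hdet : (Matrix.of fun i j => kirchhoff w (Sum.inr i) (Sum.inr j)).det ≠ 0) :
    ∃ y : Fin ni → ℝ, ∀ i, (kirchhoff w *ᵥ Sum.elim v y) (Sum.inr i) = 0 := by
  refine ⟨-((Matrix.of fun i j => kirchhoff w (Sum.inr i) (Sum.inr j))⁻¹ *ᵥ
    ((Matrix.of fun i j => kirchhoff w (Sum.inr i) (Sum.inl j)) *ᵥ v)), fun i => ?_⟩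
  have h := congrFun (Matrix.mulVec_mulVec
    ((Matrix.of fun i j => kirchhoff w (Sum.inr i) (Sum.inl j)) *ᵥ v)
    (Matrix.of fun i j => kirchhoff w (Sum.inr i) (Sum.inr j))
    (Matrix.of fun i j => kirchhoff w (Sum.inr i) (Sum.inr j))⁻¹) i
  rw [Matrix.mul_nonsing_inv _ (isUnit_iff_ne_zero.mpr hdet), Matrix.one_mulVec] at h
  rw [kirchhoff_mulVec_eq_add, Sum.elim_comp_inl, Sum.elim_comp_inr, Matrix.mulVec_neg]
  exact add_neg_eq_zero.mpr h.symm

/-- Two networks have the same response matrix if every harmonic function on the first has the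
same boundary potentials and currents as some harmonic function on the second. -/
theorem response_eq_of_harmonic {nb ni ni' : ℕ}
    (w : (Fin nb ⊕ Fin ni) → (Fin nb ⊕ Fin ni) → ℝ)
    (w' : (Fin nb ⊕ Fin ni') → (Fin nb ⊕ Fin ni') → ℝ)
    (hdet : (Matrix.of fun i j => kirchhoff w (Sum.inr i) (Sum.inr j)).det ≠ 0)
    (hdet' : (Matrix.of fun i j => kirchhoff w' (Sum.inr i) (Sum.inr j)).det ≠ 0)
    (h : ∀ v y, (∀ i, (kirchhoff w *ᵥ Sum.elim v y) (Sum.inr i) = 0) →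
      ∃ y', (∀ i, (kirchhoff w' *ᵥ Sum.elim v y') (Sum.inr i) = 0) ∧
        ∀ i, (kirchhoff w *ᵥ Sum.elim v y) (Sum.inl i)
          = (kirchhoff w' *ᵥ Sum.elim v y') (Sum.inl i)) :
    response w = response w' := by
  apply Matrix.mulVec_injective
  funext v
  obtain ⟨y, hy⟩ := exists_harmonic_extension w v hdet
  obtain ⟨y', hy', hcur⟩ := h v y hy
  have h₁ := response_mulVec_of_harmonic w _ hdet hy
  have h₂ := response_mulVec_of_harmonic w' _ hdet' hy'
  rw [Sum.elim_comp_inl] at h₁ h₂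
  rw [h₁, h₂]
  exact funext hcur

/-- **Pentagon conditional local move (reverse direction).**
With `α = ABM + AFM + AGM + ALM + BFM + BJM + BKM + FGM + FJM + FKL + FKM
+ FLM + GJM + GKM + JLM + KLM`, `β = FKL + FKM + FLM + KLM`, and `a, …, m`
defined as in the hypotheses below: the response matrix (boundary order
`(z, pl, pr, pt, t_k, t_ℓ)`, internal vertices `pbl, pbr`) of the network
`P2` equals the response matrix (boundary order `(z, pl, pr, t_m, t_k, t_ℓ)`,
internal vertices `pt, pbl, pbr`) of `P1`. -/
theorem pentagon_move_backward (A B C D E F G H I' J K L M α β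
    a b c d e f g h i j k l m : ℝ)
    (hA : 0 < A) (hB : 0 < B) (hC : 0 < C) (hD : 0 < D) (hE : 0 < E)
    (hF : 0 < F) (hG : 0 < G) (hH : 0 < H) (hI : 0 < I') (hJ : 0 < J)
    (hK : 0 < K) (hL : 0 < L) (hM : 0 < M)
    (hα : α = A * B * M + A * F * M + A * G * M + A * L * M + B * F * M
      + B * J * M + B * K * M + F * G * M + F * J * M + F * K * L
      + F * K * M + F * L * M + G * J * M + G * K * M + J * L * M
      + K * L * M)
    (hβ : β = F * K * L + F * K * M + F * L * M + K * L * M)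
    (ha : a = A * (β + B * K * M + G * K * M) / α)
    (hb : b = B * (β + A * L * M + J * L * M) / α)
    (hc : c = C + (A * B * G * I' * M + A * F * G * I' * M
      + B * F * G * I' * M + B * G * I' * J * M + B * G * I' * K * M
      - D * F * G * J * M) / (I' * α))
    (hd : d = D + D * (D * F * G * J * M + H * F * G * J * M
      + I' * F * G * J * M) / (I' * H * α))
    (he : e = E + (A * B * H * J * M + A * F * H * J * M + A * G * H * J * M
      + A * H * J * L * M + B * F * H * J * M - D * F * G * J * M)
      / (H * α))
    (hf : f = (β + B * K * M + G * K * M) * (β + A * L * M + J * L * M)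
      / (K * L * α))
    (hg : g = G * (β + A * L * M + J * L * M) / α)
    (hh : h = H + (D * F * G * J * M + H * F * G * J * M
      + I' * F * G * J * M) / (I' * α))
    (hi : i = I' + (D * F * G * J * M + H * F * G * J * M
      + I' * F * G * J * M) / (H * α))
    (hj : j = J * (β + B * K * M + G * K * M) / α)
    (hk : k = (β + B * K * M + G * K * M) / (F * L))
    (hl : l = (β + A * L * M + J * L * M) / (K * F))
    (hm : m = (H * I' * α + D * F * G * J * M + H * F * G * J * M
      + I' * F * G * J * M) / (F * G * J * M)) :
    response
        (wOf ([(Sum.inl 0, Sum.inr 1, A), (Sum.inl 0, Sum.inr 0, B),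
               (Sum.inl 0, Sum.inl 1, C), (Sum.inl 0, Sum.inl 3, D),
               (Sum.inl 0, Sum.inl 2, E), (Sum.inr 1, Sum.inr 0, F),
               (Sum.inr 0, Sum.inl 1, G), (Sum.inl 1, Sum.inl 3, H),
               (Sum.inl 3, Sum.inl 2, I'), (Sum.inl 2, Sum.inr 1, J),
               (Sum.inl 4, Sum.inr 1, K), (Sum.inl 5, Sum.inr 0, L),
               (Sum.inl 4, Sum.inl 5, M)] :
          List ((Fin 6 ⊕ Fin 2) × (Fin 6 ⊕ Fin 2) × ℝ)))
      = response
          (wOf ([(Sum.inl 0, Sum.inr 2, a), (Sum.inl 0, Sum.inr 1, b),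
                 (Sum.inl 0, Sum.inl 1, c), (Sum.inl 0, Sum.inr 0, d),
                 (Sum.inl 0, Sum.inl 2, e), (Sum.inr 2, Sum.inr 1, f),
                 (Sum.inr 1, Sum.inl 1, g), (Sum.inl 1, Sum.inr 0, h),
                 (Sum.inr 0, Sum.inl 2, i), (Sum.inl 2, Sum.inr 2, j),
                 (Sum.inl 4, Sum.inr 2, k), (Sum.inl 5, Sum.inr 1, l),
                 (Sum.inl 3, Sum.inr 0, m)] :
            List ((Fin 6 ⊕ Fin 3) × (Fin 6 ⊕ Fin 3) × ℝ))) := by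
  have hαpos : 0 < α := by rw [hα]; positivity
  have hβpos : 0 < β := by rw [hβ]; positivity
  obtain ⟨X, hX⟩ : ∃ X, X = β + B * K * M + G * K * M := ⟨_, rfl⟩
  obtain ⟨Y, hY⟩ : ∃ Y, Y = β + A * L * M + J * L * M := ⟨_, rfl⟩
  obtain ⟨W, hW⟩ : ∃ W, W = H * I' * α + (D + H + I') * F * G * J * M := ⟨_, rfl⟩
  have hXpos : 0 < X := by rw [hX]; positivity
  have hYpos : 0 < Y := by rw [hY]; positivity
  have hWpos : 0 < W := by rw [hW]; positivity
  rw [← hX] at ha hf hj hk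
  rw [← hY] at hb hf hg hl
  replace hd : d = D * W / (H * I' * α) := by rw [hd, hW]; field_simp
  replace hh : h = W / (I' * α) := by rw [hh, hW]; field_simp
  replace hi : i = W / (H * α) := by rw [hi, hW]; field_simp
  replace hm : m = W / (F * G * J * M) := by rw [hm, hW]; ring
  have hapos : 0 < a := by rw [ha]; positivity
  have hbpos : 0 < b := by rw [hb]; positivity
  have hdpos : 0 < d := by rw [hd]; positivity
  have hfpos : 0 < f := by rw [hf]; positivity
  have hgpos : 0 < g := by rw [hg]; positivity
  have hhpos : 0 < h := by rw [hh]; positivity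
  have hipos : 0 < i := by rw [hi]; positivity
  have hjpos : 0 < j := by rw [hj]; positivity
  have hkpos : 0 < k := by rw [hk]; positivity
  have hlpos : 0 < l := by rw [hl]; positivity
  have hmpos : 0 < m := by rw [hm]; positivity
  apply response_eq_of_harmonic
  · rw [Matrix.det_fin_two]
    simp [kirchhoff, wOf, Fintype.sum_sum_type, Fin.sum_univ_succ]
    have : 0 < (A + F + J + K) * (B + G + L) + F * (A + J + K) := by positivity
    apply ne_of_gt
    linarith
  · rw [Matrix.det_fin_three]
    simp [kirchhoff, wOf, Fintype.sum_sum_type, Fin.sum_univ_succ]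
    have : 0 < (d + h + i + m) * ((a + f + j + k) * (b + g + l) + f * (a + j + k)) := by
      positivity
    apply ne_of_lt
    linarith
  · intro v y hy
    have hy0 := hy 0
    have hy1 := hy 1
    rw [kirchhoff_wOf_mulVec _ _ _ (by simp)] at hy0 hy1
    simp at hy0 hy1
    have hx : v 5 = y 0 - (B * (v 0 - y 0) + F * (y 1 - y 0) + G * (v 1 - y 0)) / L := by
      field_simp
      linarith
    have hw : v 4 = y 1 - (A * (v 0 - y 1) + F * (y 0 - y 1) + J * (v 2 - y 1)) / K := by
      field_simp
      linarith
    refine ⟨![v 3 - (D * (v 3 - v 0) + H * (v 3 - v 1) + I' * (v 3 - v 2)) / m,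
      v 5 - (L * (v 5 - y 0) + M * (v 5 - v 4)) / l,
      v 4 - (K * (v 4 - y 1) + M * (v 4 - v 5)) / k], ?_, ?_⟩
    · intro i₁
      rw [kirchhoff_wOf_mulVec _ _ _ (by simp)]
      fin_cases i₁ <;>
        simp [hx, hw, ha, hb, hc, hd, he, hf, hg, hh, hi, hj, hk, hl, hm]
      · field_simp
        rw [hW]
        ring
      · field_simp
        rw [hY, hX, hα, hβ]
        ring
      · field_simp
        rw [hY, hX, hα, hβ]
        ring
    · intro i₁
      rw [kirchhoff_wOf_mulVec _ _ _ (by simp), kirchhoff_wOf_mulVec _ _ _ (by simp)]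
      fin_cases i₁ <;>
        simp [hx, hw, ha, hb, hc, hd, he, hf, hg, hh, hi, hj, hk, hl, hm]
      · field_simp
        rw [hW, hY, hX, hα, hβ]
        ring
      · field_simp
        rw [hW, hY, hα, hβ]
        ring
      · field_simp
        rw [hW, hX, hα, hβ]
        ring
      all_goals (field_simp; ring)
end

section
/- The spider graph Ξ₄ is recoverable. Precisely: consider the graph with boundary vertices v1, v2, s1, s2, z and internal vertices u1, u2, and the ten edges e1 = (v1,v2), e2 = (v1,u1), e3 = (u1,u2), e4 = (u2,v2), e5 = (u1,s1), e6 = (u2,s2), e7 = (z,v1), e8 = (z,v2), e9 = (z,u1), e10 = (z,u2). For a conductance assignment γ ∈ (ℝ_{>0})^{10} on these ten edges, let Λ(γ) denote the 5×5 response matrix (the Schur complement of the Kirchhoff matrix eliminating u1 and u2, boundary order (v1, v2, s1, s2, z)). Then the map γ ↦ Λ(γ) is injective on (ℝ_{>0})^{10}: if Λ(γ) = Λ(γ') for positive conductance assignments γ, γ', then γ = γ'. -/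
open Matrix

/-- The response matrix of the spider graph `Ξ₄`, as a function of the
conductance assignment `γ : Fin 10 → ℝ` on its ten edges.  Vertices:
boundary `v1, v2, s1, s2, z = Sum.inl 0, …, Sum.inl 4`, internal
`u1, u2 = Sum.inr 0, Sum.inr 1`.  Edges: `e1 = (v1,v2)`, `e2 = (v1,u1)`,
`e3 = (u1,u2)`, `e4 = (u2,v2)`, `e5 = (u1,s1)`, `e6 = (u2,s2)`,
`e7 = (z,v1)`, `e8 = (z,v2)`, `e9 = (z,u1)`, `e10 = (z,u2)`. -/
noncomputable def lambdaXi4 (γ : Fin 10 → ℝ) : Matrix (Fin 5) (Fin 5) ℝ :=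
  response
    (wOf ([(Sum.inl 0, Sum.inl 1, γ 0), (Sum.inl 0, Sum.inr 0, γ 1),
           (Sum.inr 0, Sum.inr 1, γ 2), (Sum.inr 1, Sum.inl 1, γ 3),
           (Sum.inr 0, Sum.inl 2, γ 4), (Sum.inr 1, Sum.inl 3, γ 5),
           (Sum.inl 4, Sum.inl 0, γ 6), (Sum.inl 4, Sum.inl 1, γ 7),
           (Sum.inl 4, Sum.inr 0, γ 8), (Sum.inl 4, Sum.inr 1, γ 9)] :
      List ((Fin 5 ⊕ Fin 2) × (Fin 5 ⊕ Fin 2) × ℝ)))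

/-- The off-diagonal entries of the response matrix of `Ξ₄`, expressed through the entries
`A`, `M`, `B` of the (negated) inverse of the internal block of the Kirchhoff matrix. -/
theorem lambdaXi4_entries (γ : Fin 10 → ℝ) (hγ : ∀ k, 0 < γ k) :
    ∃ A M B : ℝ, 0 < A ∧ 0 < M ∧ 0 < B ∧ 0 < A * B - M ^ 2 ∧
      γ 2 * (A * B - M ^ 2) = M ∧
      A * (γ 1 + γ 4 + γ 8) + M * (γ 3 + γ 5 + γ 9) = 1 ∧
      M * (γ 1 + γ 4 + γ 8) + B * (γ 3 + γ 5 + γ 9) = 1 ∧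
      lambdaXi4 γ 0 1 = γ 0 + γ 1 * γ 3 * M ∧
      lambdaXi4 γ 0 2 = γ 1 * γ 4 * A ∧
      lambdaXi4 γ 0 3 = γ 1 * γ 5 * M ∧
      lambdaXi4 γ 0 4 = γ 6 + γ 1 * (γ 8 * A + γ 9 * M) ∧
      lambdaXi4 γ 1 2 = γ 3 * γ 4 * M ∧
      lambdaXi4 γ 1 3 = γ 3 * γ 5 * B ∧
      lambdaXi4 γ 1 4 = γ 7 + γ 3 * (γ 8 * M + γ 9 * B) ∧
      lambdaXi4 γ 2 3 = γ 4 * γ 5 * M ∧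
      lambdaXi4 γ 2 4 = γ 4 * (γ 8 * A + γ 9 * M) ∧
      lambdaXi4 γ 3 4 = γ 5 * (γ 8 * M + γ 9 * B) := by
  have h1 := hγ 1
  have h2 := hγ 2
  have h3 := hγ 3
  have h4 := hγ 4
  have h5 := hγ 5
  have h8 := hγ 8
  have h9 := hγ 9
  obtain ⟨p, hp⟩ : ∃ p, p = γ 1 + γ 4 + γ 8 + γ 2 := ⟨_, rfl⟩
  obtain ⟨q, hq⟩ : ∃ q, q = γ 3 + γ 5 + γ 9 + γ 2 := ⟨_, rfl⟩
  have hp2 : γ 2 < p := by linarith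
  have hq2 : γ 2 < q := by linarith
  have hD : 0 < p * q - γ 2 ^ 2 := by nlinarith
  have hC : (Matrix.of ![![-p, γ 2], ![γ 2, -q]])⁻¹ =
      Matrix.of ![![-(q / (p * q - γ 2 ^ 2)), -(γ 2 / (p * q - γ 2 ^ 2))],
        ![-(γ 2 / (p * q - γ 2 ^ 2)), -(p / (p * q - γ 2 ^ 2))]] := by
    apply Matrix.inv_eq_right_inv
    ext i j
    fin_cases i <;> fin_cases j <;> simp [Matrix.mul_apply, Fin.sum_univ_two] <;>
      field_simp <;> ring
  have hdet : q / (p * q - γ 2 ^ 2) * (p / (p * q - γ 2 ^ 2)) - (γ 2 / (p * q - γ 2 ^ 2)) ^ 2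
      = 1 / (p * q - γ 2 ^ 2) := by
    field_simp
  have hK : (Matrix.of fun i j => kirchhoff
      (wOf ([(Sum.inl 0, Sum.inl 1, γ 0), (Sum.inl 0, Sum.inr 0, γ 1),
           (Sum.inr 0, Sum.inr 1, γ 2), (Sum.inr 1, Sum.inl 1, γ 3),
           (Sum.inr 0, Sum.inl 2, γ 4), (Sum.inr 1, Sum.inl 3, γ 5),
           (Sum.inl 4, Sum.inl 0, γ 6), (Sum.inl 4, Sum.inl 1, γ 7),
           (Sum.inl 4, Sum.inr 0, γ 8), (Sum.inl 4, Sum.inr 1, γ 9)] :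
      List ((Fin 5 ⊕ Fin 2) × (Fin 5 ⊕ Fin 2) × ℝ))) (Sum.inr i) (Sum.inr j)) =
      Matrix.of ![![-p, γ 2], ![γ 2, -q]] := by
    ext i j
    fin_cases i <;> fin_cases j <;>
      simp [kirchhoff, wOf, Fin.sum_univ_five, Fin.sum_univ_two, hp, hq]
  refine ⟨q / (p * q - γ 2 ^ 2), γ 2 / (p * q - γ 2 ^ 2), p / (p * q - γ 2 ^ 2),
    div_pos (h2.trans hq2) hD, div_pos h2 hD, div_pos (h2.trans hp2) hD,
    hdet ▸ one_div_pos.2 hD, by rw [hdet]; ring, ?_, ?_, ?_⟩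
  · rw [show γ 1 + γ 4 + γ 8 = p - γ 2 by linarith, show γ 3 + γ 5 + γ 9 = q - γ 2 by linarith,
      div_mul_eq_mul_div, div_mul_eq_mul_div, ← add_div, div_eq_one_iff_eq hD.ne']
    ring
  · rw [show γ 1 + γ 4 + γ 8 = p - γ 2 by linarith, show γ 3 + γ 5 + γ 9 = q - γ 2 by linarith,
      div_mul_eq_mul_div, div_mul_eq_mul_div, ← add_div, div_eq_one_iff_eq hD.ne']
    ring
  · unfold lambdaXi4 response
    rw [hK, hC]
    refine ⟨?_, ?_, ?_, ?_, ?_, ?_, ?_, ?_, ?_, ?_⟩ <;>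
      simp [kirchhoff, wOf, Matrix.mul_apply, Fin.sum_univ_two] <;> ring

/-- The conductances of `Ξ₄` as rational functions of its response matrix. -/
noncomputable def recoverXi4 (L : Matrix (Fin 5) (Fin 5) ℝ) : Fin 10 → ℝ :=
  let α := L 0 2 * L 2 3 / L 0 3
  let β := L 1 3 * L 2 3 / L 1 2
  let μ := L 2 3
  let r := L 0 3 / μ
  let t := L 1 2 / μ
  let x := (L 2 4 * β - μ * L 3 4) / (α * β - μ ^ 2)
  let y := (α * L 3 4 - μ * L 2 4) / (α * β - μ ^ 2)
  let b := α * (r + 1 + x) + μ * (t + 1 + y)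
  let e := μ * (r + 1 + x) + β * (t + 1 + y)
  let A := α / b ^ 2
  let M := μ / (b * e)
  let B := β / e ^ 2
  ![L 0 1 - r * b * (t * e) * M, r * b, M / (A * B - M ^ 2), t * e, b, e,
    L 0 4 - r * b * (x * b * A + y * e * M), L 1 4 - t * e * (x * b * M + y * e * B),
    x * b, y * e]

theorem recoverXi4_lambdaXi4 (γ : Fin 10 → ℝ) (hγ : ∀ k, 0 < γ k) :
    recoverXi4 (lambdaXi4 γ) = γ := by
  obtain ⟨A, M, B, hA, hM, hB, hdet, h2, hs, ht, h01, h02, h03, h04, h12, h13, h14, h23, h24,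
    h34⟩ := lambdaXi4_entries γ hγ
  have h1 := hγ 1
  have h3 := hγ 3
  have h4 := hγ 4
  have h5 := hγ 5
  have hα : lambdaXi4 γ 0 2 * lambdaXi4 γ 2 3 / lambdaXi4 γ 0 3 = γ 4 ^ 2 * A := by
    rw [h02, h23, h03]
    field_simp
  have hβ : lambdaXi4 γ 1 3 * lambdaXi4 γ 2 3 / lambdaXi4 γ 1 2 = γ 5 ^ 2 * B := by
    rw [h13, h23, h12]
    field_simp
  have hr : lambdaXi4 γ 0 3 / lambdaXi4 γ 2 3 = γ 1 / γ 4 := by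
    rw [h03, h23]
    field_simp
  have ht' : lambdaXi4 γ 1 2 / lambdaXi4 γ 2 3 = γ 3 / γ 5 := by
    rw [h12, h23]
    field_simp
  have hdet' : γ 4 ^ 2 * A * (γ 5 ^ 2 * B) - (γ 4 * γ 5 * M) ^ 2 ≠ 0 := by
    rw [show γ 4 ^ 2 * A * (γ 5 ^ 2 * B) - (γ 4 * γ 5 * M) ^ 2
      = γ 4 ^ 2 * γ 5 ^ 2 * (A * B - M ^ 2) by ring]
    positivity
  have hx : (lambdaXi4 γ 2 4 * (γ 5 ^ 2 * B) - γ 4 * γ 5 * M * lambdaXi4 γ 3 4) /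
      (γ 4 ^ 2 * A * (γ 5 ^ 2 * B) - (γ 4 * γ 5 * M) ^ 2) = γ 8 / γ 4 := by
    rw [h24, h34, div_eq_div_iff hdet' h4.ne']
    ring
  have hy : (γ 4 ^ 2 * A * lambdaXi4 γ 3 4 - γ 4 * γ 5 * M * lambdaXi4 γ 2 4) /
      (γ 4 ^ 2 * A * (γ 5 ^ 2 * B) - (γ 4 * γ 5 * M) ^ 2) = γ 9 / γ 5 := by
    rw [h24, h34, div_eq_div_iff hdet' h5.ne']
    ring
  have hb : γ 4 ^ 2 * A * (γ 1 / γ 4 + 1 + γ 8 / γ 4) +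
      γ 4 * γ 5 * M * (γ 3 / γ 5 + 1 + γ 9 / γ 5) = γ 4 := by
    field_simp
    linear_combination hs
  have he : γ 4 * γ 5 * M * (γ 1 / γ 4 + 1 + γ 8 / γ 4) +
      γ 5 ^ 2 * B * (γ 3 / γ 5 + 1 + γ 9 / γ 5) = γ 5 := by
    field_simp
    linear_combination ht
  have hA' : γ 4 ^ 2 * A / γ 4 ^ 2 = A := by field_simp
  have hM' : γ 4 * γ 5 * M / (γ 4 * γ 5) = M := by field_simp
  have hB' : γ 5 ^ 2 * B / γ 5 ^ 2 = B := by field_simp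
  have hm : M / (A * B - M ^ 2) = γ 2 := by
    rw [div_eq_iff hdet.ne', h2]
  dsimp only [recoverXi4]
  rw [hα, hβ, hr, ht', h23, hx, hy, hb, he, hA', hM', hB', hm, h01, h04, h14,
    div_mul_cancel₀ _ h4.ne', div_mul_cancel₀ _ h5.ne', div_mul_cancel₀ _ h4.ne',
    div_mul_cancel₀ _ h5.ne', add_sub_cancel_right, add_sub_cancel_right, add_sub_cancel_right]
  ext k
  fin_cases k <;> rfl

/-- **The spider graph `Ξ₄` is recoverable**: the map from positive
conductance assignments to response matrices is injective. -/
theorem xi4_recoverable (γ γ' : Fin 10 → ℝ)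
    (hγ : ∀ k, 0 < γ k) (hγ' : ∀ k, 0 < γ' k)
    (h : lambdaXi4 γ = lambdaXi4 γ') : γ = γ' := by
  rw [← recoverXi4_lambdaXi4 γ hγ, h, recoverXi4_lambdaXi4 γ' hγ']
end

section
/- The spider graph Ξ₅ is recoverable. Precisely: consider the graph with internal vertices p1, p2, p3, p4, p5 forming a pentagon with edges (p1,p2), (p2,p3), (p3,p4), (p4,p5), (p5,p1), boundary vertices s1, s2, s3, s4, s5 with spike edges (s1,p1), (s2,p2), (s3,p3), (s4,p4), (s5,p5), and a boundary vertex z with edges (z,p1), (z,p2), (z,p3), (z,p4), (z,p5) — fifteen edges in total. For a conductance assignment γ ∈ (ℝ_{>0})^{15} on these edges, let Λ(γ) denote the 6×6 response matrix (the Schur complement of the Kirchhoff matrix eliminating p1, …, p5, boundary order (s1, s2, s3, s4, s5, z)). Then the map γ ↦ Λ(γ) is injective on (ℝ_{>0})^{15}: if Λ(γ) = Λ(γ') for positive conductance assignments γ, γ', then γ = γ'. -/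
open Matrix

/-- The response matrix of the spider graph `Ξ₅`, as a function of the
conductance assignment `γ : Fin 15 → ℝ` on its fifteen edges.  Vertices:
boundary `s1, …, s5, z = Sum.inl 0, …, Sum.inl 5`, internal pentagon
vertices `p1, …, p5 = Sum.inr 0, …, Sum.inr 4`.  Edges: pentagon edges
`(p1,p2), (p2,p3), (p3,p4), (p4,p5), (p5,p1)` with conductances
`γ 0, …, γ 4`; spikes `(s_i, p_i)` with conductances `γ 5, …, γ 9`; and
`(z, p_i)` with conductances `γ 10, …, γ 14`. -/
noncomputable def lambdaXi5 (γ : Fin 15 → ℝ) : Matrix (Fin 6) (Fin 6) ℝ :=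
  response
    (wOf ([(Sum.inr 0, Sum.inr 1, γ 0), (Sum.inr 1, Sum.inr 2, γ 1),
           (Sum.inr 2, Sum.inr 3, γ 2), (Sum.inr 3, Sum.inr 4, γ 3),
           (Sum.inr 4, Sum.inr 0, γ 4),
           (Sum.inl 0, Sum.inr 0, γ 5), (Sum.inl 1, Sum.inr 1, γ 6),
           (Sum.inl 2, Sum.inr 2, γ 7), (Sum.inl 3, Sum.inr 3, γ 8),
           (Sum.inl 4, Sum.inr 4, γ 9),
           (Sum.inl 5, Sum.inr 0, γ 10), (Sum.inl 5, Sum.inr 1, γ 11),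
           (Sum.inl 5, Sum.inr 2, γ 12), (Sum.inl 5, Sum.inr 3, γ 13),
           (Sum.inl 5, Sum.inr 4, γ 14)] :
      List ((Fin 6 ⊕ Fin 5) × (Fin 6 ⊕ Fin 5) × ℝ)))

/-- The internal block of the Kirchhoff matrix of a spider graph on `Fin 5`, with pentagon
conductances `a` and total conductance `b i` from the `i`-th pentagon vertex to the boundary. -/
def pentagonBlock (a b : Fin 5 → ℝ) : Matrix (Fin 5) (Fin 5) ℝ :=
  Matrix.of fun i j =>
    if i = j then -(a i + a (i - 1) + b i) else
      if j = i + 1 then a i else if i = j + 1 then a j else 0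

lemma pentagonBlock_det_ne_zero {a b : Fin 5 → ℝ} (ha : ∀ i, 0 < a i) (hb : ∀ i, 0 < b i) :
    (pentagonBlock a b).det ≠ 0 := by
  apply det_ne_zero_of_sum_row_lt_diag
  intro k
  have hsum : ∀ f : Fin 5 → ℝ, ∑ j ∈ Finset.univ.erase k, f j = ∑ j, f j - f k := fun f => by
    rw [← Finset.sum_erase_add _ _ (Finset.mem_univ k)]; ring
  have h := hb k
  rw [hsum, Fin.sum_univ_five]
  have hneg : (-1 : Fin 5) = 4 := rfl
  have h0 := ha 0
  have h1 := ha 1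
  have h2 := ha 2
  have h3 := ha 3
  have h4 := ha 4
  fin_cases k <;>
    simp [pentagonBlock, Fin.ext_iff, Fin.val_add, abs_of_pos, *] <;>
    rw [abs_of_neg (by simp at h ⊢; linarith)] <;> simp at h ⊢ <;> linarith

/-- If two matrices whose nonzero off-diagonal entries form a five-cycle have
inverses differing, after diagonal rescaling, only on the diagonal, then the rescalings agree. -/
lemma scaling_eq_of_cyclic {C C' : Matrix (Fin 5) (Fin 5) ℝ} {s s' : Fin 5 → ℝ}
    (hC : C.det ≠ 0) (hC' : C'.det ≠ 0) (hs : ∀ i, s i ≠ 0) (hs' : ∀ i, s' i ≠ 0)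
    (h2 : ∀ i, C i (i + 2) = 0) (h3 : ∀ i, C i (i + 3) = 0) (h1 : ∀ i, C i (i + 1) ≠ 0)
    (h2' : ∀ i, C' i (i + 2) = 0) (h3' : ∀ i, C' i (i + 3) = 0) (h1' : ∀ i, C' i (i + 1) ≠ 0)
    (h : -diagonal s - diagonal s * C⁻¹ * diagonal s =
      -diagonal s' - diagonal s' * C'⁻¹ * diagonal s') : s = s' := by
  have hinv : ∀ {t : Fin 5 → ℝ}, (∀ i, t i ≠ 0) →
      diagonal (fun i => (t i)⁻¹) * diagonal t = 1 ∧
      diagonal t * diagonal (fun i => (t i)⁻¹) = 1 := fun ht => by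
    simp [ht]
  obtain ⟨hl, -⟩ := hinv hs
  obtain ⟨-, hr⟩ := hinv hs'
  have hCu : C * C⁻¹ = 1 := Matrix.mul_nonsing_inv _ hC.isUnit
  have hCu' : C'⁻¹ * C' = 1 := Matrix.nonsing_inv_mul _ hC'.isUnit
  have key : C * diagonal (fun i => (s i)⁻¹) * (diagonal s' - diagonal s) *
      diagonal (fun i => (s' i)⁻¹) * C' =
      diagonal s * diagonal (fun i => (s' i)⁻¹) * C' -
        C * diagonal (fun i => (s i)⁻¹) * diagonal s' := by
    have e : diagonal s' - diagonal s =
        diagonal s * C⁻¹ * diagonal s - diagonal s' * C'⁻¹ * diagonal s' := by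
      rw [← sub_eq_zero, ← sub_eq_zero.mpr h]
      abel
    have e1 : C * diagonal (fun i => (s i)⁻¹) * (diagonal s * C⁻¹ * diagonal s) =
        diagonal s := by
      calc _ = C * (diagonal (fun i => (s i)⁻¹) * diagonal s) * C⁻¹ * diagonal s := by
            simp only [Matrix.mul_assoc]
        _ = _ := by rw [hl, Matrix.mul_one, hCu, Matrix.one_mul]
    have e2 : diagonal s' * C'⁻¹ * diagonal s' * diagonal (fun i => (s' i)⁻¹) * C' =
        diagonal s' := by
      rw [Matrix.mul_assoc _ (diagonal s'), hr, Matrix.mul_one, Matrix.mul_assoc, hCu',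
        Matrix.mul_one]
    rw [e, Matrix.mul_sub, e1, Matrix.sub_mul, Matrix.sub_mul]
    congr 1
    simp only [Matrix.mul_assoc] at e2 ⊢
    rw [e2]
  have step : ∀ i, s (i + 1) = s' (i + 1) := fun i => by
    have hi := congrFun (congrFun key i) (i + 2)
    rw [diagonal_sub, Matrix.sub_apply] at hi
    simp only [diagonal_mul_diagonal, Matrix.mul_assoc, diagonal_mul, mul_diagonal] at hi
    rw [Matrix.mul_apply] at hi
    have hsum : ∀ f : Fin 5 → ℝ,
        ∑ j, f j = f i + f (i + 1) + f (i + 2) + f (i + 3) + f (i + 4) := fun f => by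
      rw [Fin.sum_univ_five]; fin_cases i <;> simp <;> ring
    have h43 : C' (i + 4) (i + 2) = 0 := by
      have := h3' (i + 4); rwa [show i + 4 + 3 = i + 2 by omega] at this
    have h12 := h1' (i + 1)
    rw [show i + 1 + 1 = i + 2 by omega] at h12
    rw [hsum] at hi
    simp [h2, h3, h2', h43, h1 i, h12, hs, hs', diagonal_mul] at hi
    linarith
  funext i
  simpa using step (i - 1)

/-- The edge weights of `Ξ₅` with conductances `γ`. -/
def xi5Weight (γ : Fin 15 → ℝ) : Fin 6 ⊕ Fin 5 → Fin 6 ⊕ Fin 5 → ℝ :=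
  wOf [(Sum.inr 0, Sum.inr 1, γ 0), (Sum.inr 1, Sum.inr 2, γ 1),
    (Sum.inr 2, Sum.inr 3, γ 2), (Sum.inr 3, Sum.inr 4, γ 3),
    (Sum.inr 4, Sum.inr 0, γ 4),
    (Sum.inl 0, Sum.inr 0, γ 5), (Sum.inl 1, Sum.inr 1, γ 6),
    (Sum.inl 2, Sum.inr 2, γ 7), (Sum.inl 3, Sum.inr 3, γ 8),
    (Sum.inl 4, Sum.inr 4, γ 9),
    (Sum.inl 5, Sum.inr 0, γ 10), (Sum.inl 5, Sum.inr 1, γ 11),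
    (Sum.inl 5, Sum.inr 2, γ 12), (Sum.inl 5, Sum.inr 3, γ 13),
    (Sum.inl 5, Sum.inr 4, γ 14)]

lemma xi5Weight_symm (γ : Fin 15 → ℝ) (u v : Fin 6 ⊕ Fin 5) :
    xi5Weight γ u v = xi5Weight γ v u := by
  simp only [xi5Weight, wOf, or_comm]

lemma xi5Weight_inl_inl (γ : Fin 15 → ℝ) (i j : Fin 6) :
    xi5Weight γ (Sum.inl i) (Sum.inl j) = 0 := by
  simp [xi5Weight, wOf]

lemma xi5Weight_inr_inr (γ : Fin 15 → ℝ) (i j : Fin 5) :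
    xi5Weight γ (Sum.inr i) (Sum.inr j) =
      !![0, γ 0, 0, 0, γ 4; γ 0, 0, γ 1, 0, 0; 0, γ 1, 0, γ 2, 0;
        0, 0, γ 2, 0, γ 3; γ 4, 0, 0, γ 3, 0] i j := by
  simp only [xi5Weight, wOf, List.map_cons, List.map_nil, reduceCtorEq, false_and,
    or_self, if_false, Sum.inr.injEq]
  fin_cases i <;> fin_cases j <;> simp

lemma xi5Weight_inl_castSucc_inr (γ : Fin 15 → ℝ) (i j : Fin 5) :
    xi5Weight γ (Sum.inl i.castSucc) (Sum.inr j) =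
      diagonal ![γ 5, γ 6, γ 7, γ 8, γ 9] i j := by
  simp only [xi5Weight, wOf, List.map_cons, List.map_nil, reduceCtorEq, false_and, and_false,
    or_false, or_self, if_false, Sum.inr.injEq, Sum.inl.injEq]
  fin_cases i <;> fin_cases j <;> simp [diagonal]

lemma xi5Weight_inl_last_inr (γ : Fin 15 → ℝ) (j : Fin 5) :
    xi5Weight γ (Sum.inl (Fin.last 5)) (Sum.inr j) =
      ![γ 10, γ 11, γ 12, γ 13, γ 14] j := by
  simp only [xi5Weight, wOf, List.map_cons, List.map_nil, reduceCtorEq, false_and, and_false,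
    or_false, or_self, if_false, Sum.inr.injEq, Sum.inl.injEq]
  fin_cases j <;> simp [Fin.ext_iff]

/-- The response matrix of `Ξ₅` restricted to the spike vertices. -/
lemma lambdaXi5_spike_block (γ : Fin 15 → ℝ) :
    (lambdaXi5 γ).submatrix Fin.castSucc Fin.castSucc =
      -diagonal ![γ 5, γ 6, γ 7, γ 8, γ 9] -
        diagonal ![γ 5, γ 6, γ 7, γ 8, γ 9] *
          (pentagonBlock ![γ 0, γ 1, γ 2, γ 3, γ 4]
            ![γ 5 + γ 10, γ 6 + γ 11, γ 7 + γ 12, γ 8 + γ 13, γ 9 + γ 14])⁻¹ *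
          diagonal ![γ 5, γ 6, γ 7, γ 8, γ 9] := by
  rw [lambdaXi5, ← xi5Weight, response, submatrix_sub, Pi.sub_apply, Pi.sub_apply,
    submatrix_mul _ _ Fin.castSucc id Fin.castSucc Function.bijective_id,
    submatrix_mul _ _ Fin.castSucc id id Function.bijective_id, submatrix_id_id]
  congr 1
  · ext i j
    by_cases hij : i = j
    · subst hij
      simp [kirchhoff, xi5Weight_inl_inl, xi5Weight_inl_castSucc_inr, diagonal]
    · simp [kirchhoff, hij, xi5Weight_inl_inl]
  · congr 1
    · congr 1
      · ext i j
        simp [kirchhoff, xi5Weight_inl_castSucc_inr]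
      · congr 1
        ext i j
        simp only [kirchhoff, of_apply, Fintype.sum_sum_type, Fin.sum_univ_castSucc (n := 5),
          xi5Weight_symm γ (Sum.inr _) (Sum.inl _), xi5Weight_inl_castSucc_inr,
          xi5Weight_inl_last_inr, xi5Weight_inr_inr, pentagonBlock]
        fin_cases i <;> fin_cases j <;>
          simp [Fin.sum_univ_five] <;> ring
    · ext i j
      simp [kirchhoff, xi5Weight_symm γ (Sum.inr _) (Sum.inl _), xi5Weight_inl_castSucc_inr,
        diagonal_apply, eq_comm]
      grind

lemma pentagonBlock_add_one (a b : Fin 5 → ℝ) (i : Fin 5) :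
    pentagonBlock a b i (i + 1) = a i := by
  simp [pentagonBlock]

lemma pentagonBlock_add_two (a b : Fin 5 → ℝ) (i : Fin 5) :
    pentagonBlock a b i (i + 2) = 0 := by
  fin_cases i <;> simp [pentagonBlock, Fin.ext_iff, Fin.val_add]

lemma pentagonBlock_add_three (a b : Fin 5 → ℝ) (i : Fin 5) :
    pentagonBlock a b i (i + 3) = 0 := by
  fin_cases i <;> simp [pentagonBlock, Fin.ext_iff, Fin.val_add]

lemma pentagonBlock_injective {a b a' b' : Fin 5 → ℝ}
    (h : pentagonBlock a b = pentagonBlock a' b') : a = a' ∧ b = b' := by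
  have ha : a = a' := funext fun i => by
    simpa only [pentagonBlock_add_one] using congrFun (congrFun h i) (i + 1)
  refine ⟨ha, funext fun i => ?_⟩
  have hi := congrFun (congrFun h i) i
  simp only [pentagonBlock, of_apply, if_true, ha] at hi
  linarith

/-- **The spider graph `Ξ₅` is recoverable**: the map from positive
conductance assignments to response matrices is injective. -/
theorem xi5_recoverable (γ γ' : Fin 15 → ℝ)
    (hγ : ∀ k, 0 < γ k) (hγ' : ∀ k, 0 < γ' k)
    (h : lambdaXi5 γ = lambdaXi5 γ') : γ = γ' := by
  have hL := congrArg (fun M => M.submatrix Fin.castSucc Fin.castSucc) h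
  simp only [lambdaXi5_spike_block] at hL
  have pos : ∀ δ : Fin 15 → ℝ, (∀ k, 0 < δ k) →
      (∀ i, 0 < ![δ 0, δ 1, δ 2, δ 3, δ 4] i) ∧ (∀ i, 0 < ![δ 5, δ 6, δ 7, δ 8, δ 9] i) ∧
      ∀ i, 0 < ![δ 5 + δ 10, δ 6 + δ 11, δ 7 + δ 12, δ 8 + δ 13, δ 9 + δ 14] i :=
    fun δ hδ => by
      refine ⟨fun i => ?_, fun i => ?_, fun i => ?_⟩ <;> fin_cases i <;> simp [hδ, add_pos]
  obtain ⟨ha, hs, hb⟩ := pos γ hγ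
  obtain ⟨ha', hs', hb'⟩ := pos γ' hγ'
  have hC := pentagonBlock_det_ne_zero ha hb
  have hC' := pentagonBlock_det_ne_zero ha' hb'
  have hss := scaling_eq_of_cyclic hC hC' (fun i => (hs i).ne') (fun i => (hs' i).ne')
    (pentagonBlock_add_two _ _) (pentagonBlock_add_three _ _)
    (fun i => by rw [pentagonBlock_add_one]; exact (ha i).ne')
    (pentagonBlock_add_two _ _) (pentagonBlock_add_three _ _)
    (fun i => by rw [pentagonBlock_add_one]; exact (ha' i).ne') hL
  rw [← hss] at hL
  have hCC := Matrix.inv_inj (Matrix.ext fun i j => by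
    have hij := congrFun (congrFun hL i) j
    simp only [Matrix.sub_apply, mul_diagonal, diagonal_mul] at hij
    exact mul_left_cancel₀ (hs i).ne' (mul_right_cancel₀ (hs j).ne' (sub_right_injective hij))) hC.isUnit
  obtain ⟨haa, hbb⟩ := pentagonBlock_injective hCC
  have e0 := fun i => congrFun haa i
  have e1 := fun i => congrFun hss i
  have e2 := fun i => congrFun hbb i
  simp [Fin.forall_fin_succ] at e0 e1 e2
  funext k
  fin_cases k <;> simp <;> linarith
end

section
/- The spider graph Ξ₆ is recoverable. Precisely: consider the graph with internal vertices h1, …, h6 forming a hexagon with edges (h1,h2), (h2,h3), (h3,h4), (h4,h5), (h5,h6), (h6,h1), boundary vertices t1, …, t6 with spike edges (t_i, h_i) for i = 1, …, 6, boundary edges (t1,t2), (t2,t3), (t3,t4), and a boundary vertex z with edges (z,h_i) for i = 1, …, 6 — twenty-one edges in total. For a conductance assignment γ ∈ (ℝ_{>0})^{21} on these edges, let Λ(γ) denote the 7×7 response matrix (the Schur complement of the Kirchhoff matrix eliminating h1, …, h6, boundary order (t1, …, t6, z)). Then the map γ ↦ Λ(γ) is injective on (ℝ_{>0})^{21}: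 if Λ(γ) = Λ(γ') for positive conductance assignments γ, γ', then γ = γ'. -/
open Matrix

/-- The response matrix of the spider graph `Ξ₆`, as a function of the
conductance assignment `γ : Fin 21 → ℝ` on its twenty-one edges.  Vertices:
boundary `t1, …, t6, z = Sum.inl 0, …, Sum.inl 6`, internal hexagon
vertices `h1, …, h6 = Sum.inr 0, …, Sum.inr 5`.  Edges: hexagon edges
`(h1,h2), …, (h6,h1)` with conductances `γ 0, …, γ 5`; spikes `(t_i, h_i)`
with conductances `γ 6, …, γ 11`; boundary edges `(t1,t2), (t2,t3), (t3,t4)`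
with conductances `γ 12, γ 13, γ 14`; and `(z, h_i)` with conductances
`γ 15, …, γ 20`. -/
noncomputable def lambdaXi6 (γ : Fin 21 → ℝ) : Matrix (Fin 7) (Fin 7) ℝ :=
  response
    (wOf ([(Sum.inr 0, Sum.inr 1, γ 0), (Sum.inr 1, Sum.inr 2, γ 1),
           (Sum.inr 2, Sum.inr 3, γ 2), (Sum.inr 3, Sum.inr 4, γ 3),
           (Sum.inr 4, Sum.inr 5, γ 4), (Sum.inr 5, Sum.inr 0, γ 5),
           (Sum.inl 0, Sum.inr 0, γ 6), (Sum.inl 1, Sum.inr 1, γ 7),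
           (Sum.inl 2, Sum.inr 2, γ 8), (Sum.inl 3, Sum.inr 3, γ 9),
           (Sum.inl 4, Sum.inr 4, γ 10), (Sum.inl 5, Sum.inr 5, γ 11),
           (Sum.inl 0, Sum.inl 1, γ 12), (Sum.inl 1, Sum.inl 2, γ 13),
           (Sum.inl 2, Sum.inl 3, γ 14),
           (Sum.inl 6, Sum.inr 0, γ 15), (Sum.inl 6, Sum.inr 1, γ 16),
           (Sum.inl 6, Sum.inr 2, γ 17), (Sum.inl 6, Sum.inr 3, γ 18),
           (Sum.inl 6, Sum.inr 4, γ 19), (Sum.inl 6, Sum.inr 5, γ 20)] :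
      List ((Fin 7 ⊕ Fin 6) × (Fin 7 ⊕ Fin 6) × ℝ)))

/-- The edge-weight function of `Ξ₆` underlying `lambdaXi6`. -/
def xi6Weight (γ : Fin 21 → ℝ) : Fin 7 ⊕ Fin 6 → Fin 7 ⊕ Fin 6 → ℝ :=
    (wOf ([(Sum.inr 0, Sum.inr 1, γ 0), (Sum.inr 1, Sum.inr 2, γ 1),
           (Sum.inr 2, Sum.inr 3, γ 2), (Sum.inr 3, Sum.inr 4, γ 3),
           (Sum.inr 4, Sum.inr 5, γ 4), (Sum.inr 5, Sum.inr 0, γ 5),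
           (Sum.inl 0, Sum.inr 0, γ 6), (Sum.inl 1, Sum.inr 1, γ 7),
           (Sum.inl 2, Sum.inr 2, γ 8), (Sum.inl 3, Sum.inr 3, γ 9),
           (Sum.inl 4, Sum.inr 4, γ 10), (Sum.inl 5, Sum.inr 5, γ 11),
           (Sum.inl 0, Sum.inl 1, γ 12), (Sum.inl 1, Sum.inl 2, γ 13),
           (Sum.inl 2, Sum.inl 3, γ 14),
           (Sum.inl 6, Sum.inr 0, γ 15), (Sum.inl 6, Sum.inr 1, γ 16),
           (Sum.inl 6, Sum.inr 2, γ 17), (Sum.inl 6, Sum.inr 3, γ 18),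
           (Sum.inl 6, Sum.inr 4, γ 19), (Sum.inl 6, Sum.inr 5, γ 20)] :
      List ((Fin 7 ⊕ Fin 6) × (Fin 7 ⊕ Fin 6) × ℝ)))

/-- The internal (hexagon) block of the Kirchhoff matrix of `Ξ₆`. -/
def hexBlock (γ : Fin 21 → ℝ) : Matrix (Fin 6) (Fin 6) ℝ :=
  !![-(γ 0 + γ 5 + γ 6 + γ 15), γ 0, 0, 0, 0, γ 5;
     γ 0, -(γ 0 + γ 1 + γ 7 + γ 16), γ 1, 0, 0, 0;
     0, γ 1, -(γ 1 + γ 2 + γ 8 + γ 17), γ 2, 0, 0;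
     0, 0, γ 2, -(γ 2 + γ 3 + γ 9 + γ 18), γ 3, 0;
     0, 0, 0, γ 3, -(γ 3 + γ 4 + γ 10 + γ 19), γ 4;
     γ 5, 0, 0, 0, γ 4, -(γ 4 + γ 5 + γ 11 + γ 20)]

/-- The block of the Kirchhoff matrix of `Ξ₆` indexed by the spike ends `t₁, …, t₆`. -/
def spikeEndBlock (γ : Fin 21 → ℝ) : Matrix (Fin 6) (Fin 6) ℝ :=
  !![-(γ 6 + γ 12), γ 12, 0, 0, 0, 0;
     γ 12, -(γ 7 + γ 12 + γ 13), γ 13, 0, 0, 0;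
     0, γ 13, -(γ 8 + γ 13 + γ 14), γ 14, 0, 0;
     0, 0, γ 14, -(γ 9 + γ 14), 0, 0;
     0, 0, 0, 0, -γ 10, 0;
     0, 0, 0, 0, 0, -γ 11]

/-- The conductances of the spikes. -/
def spike (γ : Fin 21 → ℝ) : Fin 6 → ℝ := ![γ 6, γ 7, γ 8, γ 9, γ 10, γ 11]

theorem xi6Weight_comm (γ : Fin 21 → ℝ) (u v : Fin 7 ⊕ Fin 6) :
    xi6Weight γ u v = xi6Weight γ v u := by
  simp only [xi6Weight, wOf, or_comm]

theorem xi6Weight_inr_inr (γ : Fin 21 → ℝ) (i j : Fin 6) :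
    xi6Weight γ (Sum.inr i) (Sum.inr j) =
      !![0, γ 0, 0, 0, 0, γ 5;
         γ 0, 0, γ 1, 0, 0, 0;
         0, γ 1, 0, γ 2, 0, 0;
         0, 0, γ 2, 0, γ 3, 0;
         0, 0, 0, γ 3, 0, γ 4;
         γ 5, 0, 0, 0, γ 4, 0] i j := by
  simp only [xi6Weight, wOf, List.map_cons, List.map_nil, List.sum_cons, List.sum_nil,
    Sum.inr.injEq, reduceCtorEq, and_false, false_and, or_false, if_false, add_zero]
  fin_cases i <;> fin_cases j <;> simp

theorem xi6Weight_inr_inl (γ : Fin 21 → ℝ) (i : Fin 6) (j : Fin 7) :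
    xi6Weight γ (Sum.inr i) (Sum.inl j) =
      !![γ 6, 0, 0, 0, 0, 0, γ 15;
         0, γ 7, 0, 0, 0, 0, γ 16;
         0, 0, γ 8, 0, 0, 0, γ 17;
         0, 0, 0, γ 9, 0, 0, γ 18;
         0, 0, 0, 0, γ 10, 0, γ 19;
         0, 0, 0, 0, 0, γ 11, γ 20] i j := by
  simp only [xi6Weight, wOf, List.map_cons, List.map_nil, List.sum_cons, List.sum_nil,
    Sum.inr.injEq, Sum.inl.injEq, reduceCtorEq, and_false, false_and, false_or, or_false,
    if_false, zero_add, add_zero]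
  fin_cases i <;> fin_cases j <;> simp

theorem xi6Weight_inl_inl (γ : Fin 21 → ℝ) (i j : Fin 7) :
    xi6Weight γ (Sum.inl i) (Sum.inl j) =
      !![0, γ 12, 0, 0, 0, 0, 0;
         γ 12, 0, γ 13, 0, 0, 0, 0;
         0, γ 13, 0, γ 14, 0, 0, 0;
         0, 0, γ 14, 0, 0, 0, 0;
         0, 0, 0, 0, 0, 0, 0;
         0, 0, 0, 0, 0, 0, 0;
         0, 0, 0, 0, 0, 0, 0] i j := by
  simp only [xi6Weight, wOf, List.map_cons, List.map_nil, List.sum_cons, List.sum_nil,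
    Sum.inl.injEq, reduceCtorEq, and_false, or_false, if_false, zero_add, add_zero]
  fin_cases i <;> fin_cases j <;> simp

theorem kirchhoff_xi6_inr_inr (γ : Fin 21 → ℝ) :
    (of fun i j => kirchhoff (xi6Weight γ) (Sum.inr i) (Sum.inr j)) = hexBlock γ := by
  ext i j
  simp only [kirchhoff, of_apply, Sum.inr.injEq, Fintype.sum_sum_type, xi6Weight_inr_inr,
    xi6Weight_inr_inl]
  fin_cases i <;> fin_cases j <;> simp [hexBlock, Fin.sum_univ_succ] <;> ring

theorem kirchhoff_xi6_inl_inl (γ : Fin 21 → ℝ) (i j : Fin 6) :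
    kirchhoff (xi6Weight γ) (Sum.inl i.castSucc) (Sum.inl j.castSucc) =
      spikeEndBlock γ i j := by
  simp only [kirchhoff, of_apply, Sum.inl.injEq, Fintype.sum_sum_type, xi6Weight_inl_inl,
    xi6Weight_comm γ (Sum.inl _) (Sum.inr _), xi6Weight_inr_inl]
  fin_cases i <;> fin_cases j <;> simp [spikeEndBlock, Fin.sum_univ_succ] <;> ring

theorem kirchhoff_xi6_inr_inl (γ : Fin 21 → ℝ) (i j : Fin 6) :
    kirchhoff (xi6Weight γ) (Sum.inr i) (Sum.inl j.castSucc) = diagonal (spike γ) i j := by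
  simp only [kirchhoff, of_apply, reduceCtorEq, if_false, xi6Weight_inr_inl]
  fin_cases i <;> fin_cases j <;> simp [spike]

theorem kirchhoff_xi6_inl_inr (γ : Fin 21 → ℝ) (i j : Fin 6) :
    kirchhoff (xi6Weight γ) (Sum.inl i.castSucc) (Sum.inr j) = diagonal (spike γ) i j := by
  rw [← diagonal_transpose, transpose_apply, ← kirchhoff_xi6_inr_inl]
  simp [kirchhoff, xi6Weight_comm γ (Sum.inl _)]

theorem lambdaXi6_castSucc_castSucc (γ : Fin 21 → ℝ) (i j : Fin 6) :
    lambdaXi6 γ i.castSucc j.castSucc =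
      (spikeEndBlock γ - diagonal (spike γ) * (hexBlock γ)⁻¹ * diagonal (spike γ)) i j := by
  change response (xi6Weight γ) _ _ = _
  rw [response, kirchhoff_xi6_inr_inr, Matrix.sub_apply, Matrix.sub_apply, of_apply,
    kirchhoff_xi6_inl_inl]
  simp only [mul_apply, of_apply, kirchhoff_xi6_inl_inr, kirchhoff_xi6_inr_inl]

theorem spike_pos {γ : Fin 21 → ℝ} (hγ : ∀ k, 0 < γ k) (i : Fin 6) : 0 < spike γ i := by
  fin_cases i <;> simp [spike, hγ]

theorem det_hexBlock_ne_zero {γ : Fin 21 → ℝ} (hγ : ∀ k, 0 < γ k) : (hexBlock γ).det ≠ 0 := by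
  apply det_ne_zero_of_sum_row_lt_diag
  have h (a b c d : Fin 21) : |γ a + γ b + γ c + γ d| = γ a + γ b + γ c + γ d :=
    abs_of_pos (by linarith [hγ a, hγ b, hγ c, hγ d])
  have h' (a : Fin 21) : |γ a| = γ a := abs_of_pos (hγ a)
  intro k
  rw [Finset.sum_erase_eq_sub (Finset.mem_univ k), Fin.sum_univ_six]
  fin_cases k <;> simp [hexBlock, -neg_add_rev, h, h'] <;>
    linarith [hγ 6, hγ 7, hγ 8, hγ 9, hγ 10, hγ 11, hγ 15, hγ 16, hγ 17, hγ 18, hγ 19, hγ 20]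

theorem hexBlock_eq_zero (γ : Fin 21 → ℝ) (i : Fin 6) :
    hexBlock γ i (i + 2) = 0 ∧ hexBlock γ i (i + 3) = 0 ∧ hexBlock γ i (i + 4) = 0 := by
  fin_cases i <;> exact ⟨rfl, rfl, rfl⟩

theorem hexBlock_pos {γ : Fin 21 → ℝ} (hγ : ∀ k, 0 < γ k) (i : Fin 6) :
    0 < hexBlock γ i (i + 1) ∧ 0 < hexBlock γ (i + 1) i := by
  fin_cases i <;> exact ⟨hγ _, hγ _⟩

/-- The inverse of a nondegenerate matrix supported on a hexagon has no nonzero perturbation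
supported on the diagonal and three consecutive edges whose inverse is again supported on the
hexagon.  With `P = N⁻¹`, `P' = N'⁻¹` and `Δ = P - P'`, one has `N * Δ * N' = N' - N`. -/
theorem eq_zero_of_mul_mul_eq_sub {N N' Δ : Matrix (Fin 6) (Fin 6) ℝ}
    (hN : ∀ i, N i (i + 2) = 0 ∧ N i (i + 3) = 0 ∧ N i (i + 4) = 0)
    (hN' : ∀ i, N' i (i + 2) = 0 ∧ N' i (i + 3) = 0 ∧ N' i (i + 4) = 0)
    (hN0 : ∀ i, N i (i + 1) ≠ 0 ∧ N (i + 1) i ≠ 0)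
    (hN0' : ∀ i, N' i (i + 1) ≠ 0 ∧ N' (i + 1) i ≠ 0)
    {d : Fin 6 → ℝ} {b₁ b₂ b₃ : ℝ}
    (hΔ : Δ = !![d 0, b₁, 0, 0, 0, 0; b₁, d 1, b₂, 0, 0, 0; 0, b₂, d 2, b₃, 0, 0;
      0, 0, b₃, d 3, 0, 0; 0, 0, 0, 0, d 4, 0; 0, 0, 0, 0, 0, d 5])
    (h : N * Δ * N' = N' - N) : Δ = 0 := by
  have hz i j (h1 : N i j = 0) (h2 : N' i j = 0) := congrFun (congrFun h i) j |>.trans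
    (by rw [Matrix.sub_apply, h1, h2, sub_zero])
  simp only [hΔ, mul_apply, Fin.sum_univ_six] at hz
  simp [Fin.forall_fin_succ] at hN hN' hN0 hN0'
  have hb₃ : b₃ = 0 := by simpa [hN, hN', hN0, hN0'] using hz 1 4
  have hb₂ : b₂ = 0 := by simpa [hN, hN', hN0, hN0'] using hz 0 3
  have hb₁ : b₁ = 0 := by simpa [hN, hN', hN0, hN0'] using hz 2 5
  subst hb₁ hb₂ hb₃
  have hd : d = 0 := by
    ext i
    have hi := hz (i + 5) (i + 1)
    fin_cases i <;> simpa [hN, hN', hN0, hN0'] using hi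
  ext i j
  rw [hΔ, hd]
  fin_cases i <;> fin_cases j <;> rfl

theorem spikeEndBlock_sub (γ γ' : Fin 21 → ℝ) :
    spikeEndBlock γ - spikeEndBlock γ' =
      !![(spikeEndBlock γ - spikeEndBlock γ').diag 0, γ 12 - γ' 12, 0, 0, 0, 0;
        γ 12 - γ' 12, (spikeEndBlock γ - spikeEndBlock γ').diag 1, γ 13 - γ' 13, 0, 0, 0;
        0, γ 13 - γ' 13, (spikeEndBlock γ - spikeEndBlock γ').diag 2, γ 14 - γ' 14, 0, 0;
        0, 0, γ 14 - γ' 14, (spikeEndBlock γ - spikeEndBlock γ').diag 3, 0, 0;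
        0, 0, 0, 0, (spikeEndBlock γ - spikeEndBlock γ').diag 4, 0;
        0, 0, 0, 0, 0, (spikeEndBlock γ - spikeEndBlock γ').diag 5] := by
  ext i j
  fin_cases i <;> fin_cases j <;> first | rfl | exact sub_self (0 : ℝ)

/-- The inverse of the Schur complement term `S * (hexBlock γ)⁻¹ * S`, where `S` is the diagonal
matrix of spike conductances. -/
noncomputable def scaledHexBlock (γ : Fin 21 → ℝ) : Matrix (Fin 6) (Fin 6) ℝ :=
  diagonal (spike γ)⁻¹ * hexBlock γ * diagonal (spike γ)⁻¹

theorem scaledHexBlock_apply (γ : Fin 21 → ℝ) (i j : Fin 6) :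
    scaledHexBlock γ i j = (spike γ i)⁻¹ * hexBlock γ i j * (spike γ j)⁻¹ := by
  simp [scaledHexBlock]

theorem scaledHexBlock_eq_zero (γ : Fin 21 → ℝ) (i : Fin 6) :
    scaledHexBlock γ i (i + 2) = 0 ∧ scaledHexBlock γ i (i + 3) = 0 ∧
      scaledHexBlock γ i (i + 4) = 0 := by
  simp [scaledHexBlock_apply, hexBlock_eq_zero]

theorem scaledHexBlock_ne_zero {γ : Fin 21 → ℝ} (hγ : ∀ k, 0 < γ k) (i : Fin 6) :
    scaledHexBlock γ i (i + 1) ≠ 0 ∧ scaledHexBlock γ (i + 1) i ≠ 0 := by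
  simp [scaledHexBlock_apply, (hexBlock_pos hγ i).1.ne', (hexBlock_pos hγ i).2.ne',
    (spike_pos hγ _).ne']

theorem scaledHexBlock_mul {γ : Fin 21 → ℝ} (hγ : ∀ k, 0 < γ k) :
    scaledHexBlock γ * (diagonal (spike γ) * (hexBlock γ)⁻¹ * diagonal (spike γ)) = 1 := by
  have h₁ : diagonal (spike γ)⁻¹ * diagonal (spike γ) = 1 := by
    simp [diagonal_mul_diagonal, (spike_pos hγ _).ne']
  have h₂ := mul_nonsing_inv (hexBlock γ) (det_hexBlock_ne_zero hγ).isUnit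
  calc scaledHexBlock γ * (diagonal (spike γ) * (hexBlock γ)⁻¹ * diagonal (spike γ))
      = diagonal (spike γ)⁻¹ * (hexBlock γ * (diagonal (spike γ)⁻¹ * diagonal (spike γ)) *
          (hexBlock γ)⁻¹) * diagonal (spike γ) := by
        simp only [scaledHexBlock, Matrix.mul_assoc]
    _ = 1 := by rw [h₁, Matrix.mul_one, h₂, Matrix.mul_one, h₁]

theorem scaledHexBlock_mul_sub_mul {γ γ' : Fin 21 → ℝ} (hγ : ∀ k, 0 < γ k) (hγ' : ∀ k, 0 < γ' k)
    (h : lambdaXi6 γ = lambdaXi6 γ') :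
    scaledHexBlock γ * (spikeEndBlock γ - spikeEndBlock γ') * scaledHexBlock γ' =
      scaledHexBlock γ' - scaledHexBlock γ := by
  have hΛ : spikeEndBlock γ - diagonal (spike γ) * (hexBlock γ)⁻¹ * diagonal (spike γ) =
      spikeEndBlock γ' - diagonal (spike γ') * (hexBlock γ')⁻¹ * diagonal (spike γ') := by
    ext i j
    rw [← lambdaXi6_castSucc_castSucc, h, lambdaXi6_castSucc_castSucc]
  rw [sub_eq_sub_iff_sub_eq_sub.1 hΛ, Matrix.mul_sub, Matrix.sub_mul, scaledHexBlock_mul hγ,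
    Matrix.one_mul, Matrix.mul_assoc, mul_eq_one_comm.1 (scaledHexBlock_mul hγ'), Matrix.mul_one]

/-- **The spider graph `Ξ₆` is recoverable**: the map from positive
conductance assignments to response matrices is injective. -/
theorem xi6_recoverable (γ γ' : Fin 21 → ℝ)
    (hγ : ∀ k, 0 < γ k) (hγ' : ∀ k, 0 < γ' k)
    (h : lambdaXi6 γ = lambdaXi6 γ') : γ = γ' := by

  have hΔ := scaledHexBlock_mul_sub_mul hγ hγ' h
  have hsub : spikeEndBlock γ - spikeEndBlock γ' = 0 :=
    eq_zero_of_mul_mul_eq_sub (scaledHexBlock_eq_zero γ) (scaledHexBlock_eq_zero γ')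
      (scaledHexBlock_ne_zero hγ) (scaledHexBlock_ne_zero hγ') (spikeEndBlock_sub γ γ') hΔ
  have hscaled : scaledHexBlock γ = scaledHexBlock γ' := by
    rw [hsub, Matrix.mul_zero, Matrix.zero_mul] at hΔ
    exact (sub_eq_zero.1 hΔ.symm).symm
  have hend i j : spikeEndBlock γ i j = spikeEndBlock γ' i j := by rw [sub_eq_zero.1 hsub]
  have h12 : γ 12 = γ' 12 := hend 0 1
  have h13 : γ 13 = γ' 13 := hend 1 2
  have h14 : γ 14 = γ' 14 := hend 2 3
  have hspike : spike γ = spike γ' := by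
    ext i
    have := hend i i
    fin_cases i <;> simp [spikeEndBlock] at this <;> simp [spike] <;> linarith
  have hhex i j : hexBlock γ i j = hexBlock γ' i j := by
    have := congrFun (congrFun hscaled i) j
    simpa [scaledHexBlock_apply, hspike, (spike_pos hγ' _).ne'] using this
  have hs i := congrFun hspike i
  have e0 := hhex 0 0
  have e1 := hhex 1 1
  have e2 := hhex 2 2
  have e3 := hhex 3 3
  have e4 := hhex 4 4
  have e5 := hhex 5 5
  have a0 : γ 0 = γ' 0 := hhex 0 1
  have a1 : γ 1 = γ' 1 := hhex 1 2
  have a2 : γ 2 = γ' 2 := hhex 2 3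
  have a3 : γ 3 = γ' 3 := hhex 3 4
  have a4 : γ 4 = γ' 4 := hhex 4 5
  have a5 : γ 5 = γ' 5 := hhex 5 0
  have s0 : γ 6 = γ' 6 := hs 0
  have s1 : γ 7 = γ' 7 := hs 1
  have s2 : γ 8 = γ' 8 := hs 2
  have s3 : γ 9 = γ' 9 := hs 3
  have s4 : γ 10 = γ' 10 := hs 4
  have s5 : γ 11 = γ' 11 := hs 5
  simp [hexBlock] at e0 e1 e2 e3 e4 e5
  ext k
  fin_cases k <;> simp <;> linarith
end
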